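/- Let H be a real Hilbert space, let λ > 0, and let A and B be maximally monotone set-valued operators on H. Suppose (x_n), (y_n) are sequences in H converging weakly to x and y respectively, and (a_n), (b_n) are sequences converging strongly (in norm) to a and b respectively, such that for every n: a_n − y_n ∈ λA(x_n) and y_n ∈ λB(x_n + b_n). Then a − y ∈ λA(x) and y ∈ λB(x + b). In other words, the set-valued operator on H × H given by (x,y) ↦ (λA(x) + y) × ((λB)^{-1}(y) − x) has a graph that is sequentially closed in the weak–strong topology. -/

import Mathlib

open scoped RealInnerProductSpace
open Filter

/-- A set-valued operator `A ⊆ H × H` is monotone. -/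
def IsMonotoneOp {H : Type*} [NormedAddCommGroup H] [InnerProductSpace ℝ H]
    (A : Set (H × H)) : Prop :=
  ∀ p ∈ A, ∀ q ∈ A, (0 : ℝ) ≤ ⟪p.2 - q.2, p.1 - q.1⟫

/-- Maximal monotonicity. -/
def IsMaximalMonotoneOp {H : Type*} [NormedAddCommGroup H] [InnerProductSpace ℝ H]
    (A : Set (H × H)) : Prop :=
  IsMonotoneOp A ∧
    ∀ p : H × H, (∀ q ∈ A, (0 : ℝ) ≤ ⟪p.2 - q.2, p.1 - q.1⟫) → p ∈ A

/-- The scaled operator `cA = {(x, c•u) : (x,u) ∈ A}`. -/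
def smulOp {H : Type*} [NormedAddCommGroup H] [InnerProductSpace ℝ H]
    (c : ℝ) (A : Set (H × H)) : Set (H × H) :=
  (fun p : H × H => (p.1, c • p.2)) '' A

theorem smulOp_maximal {H : Type*} [NormedAddCommGroup H] [InnerProductSpace ℝ H]
    (c : ℝ) (hc : 0 < c) (A : Set (H × H)) (hA : IsMaximalMonotoneOp A) :
    IsMaximalMonotoneOp (smulOp c A) := by
  constructor
  · rintro _ ⟨p, hp, rfl⟩ _ ⟨q, hq, rfl⟩
    have h := hA.1 p hp q hq
    simp only [← smul_sub, real_inner_smul_left]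
    positivity
  · intro p hp
    refine ⟨(p.1, c⁻¹ • p.2), hA.2 _ ?_, ?_⟩
    · intro q hq
      have h := hp _ ⟨q, hq, rfl⟩
      have e : c⁻¹ • p.2 - q.2 = c⁻¹ • (p.2 - c • q.2) := by
        rw [smul_sub, smul_smul, inv_mul_cancel₀ hc.ne', one_smul]
      simp only [e, real_inner_smul_left]
      exact mul_nonneg (inv_nonneg.2 hc.le) h
    · simp [smul_smul, mul_inv_cancel₀ hc.ne']

theorem weak_strong_inner {H : Type*} [NormedAddCommGroup H] [InnerProductSpace ℝ H]
    [CompleteSpace H] (x a : ℕ → H) (xbar abar : H)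
    (hx : ∀ w : H, Tendsto (fun n => ⟪x n, w⟫) atTop (nhds ⟪xbar, w⟫))
    (ha : Tendsto a atTop (nhds abar)) :
    Tendsto (fun n => ⟪x n, a n⟫) atTop (nhds ⟪xbar, abar⟫) := by
  obtain ⟨C, hC⟩ : ∃ C, ∀ n, ‖innerSL ℝ (x n)‖ ≤ C := by
    apply banach_steinhaus
    intro w
    obtain ⟨C, hC⟩ := (hx w).norm.bddAbove_range
    exact ⟨C, fun n => hC ⟨n, rfl⟩⟩
  have h0 : Tendsto (fun n => ⟪x n, a n - abar⟫) atTop (nhds 0) := by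
    have h1 : Tendsto (fun n => C * ‖a n - abar‖) atTop (nhds 0) := by
      have := (tendsto_iff_norm_sub_tendsto_zero.1 ha).const_mul C
      simpa using this
    refine squeeze_zero_norm (fun n => ?_) h1
    refine (norm_inner_le_norm _ _).trans ?_
    have := hC n
    rw [innerSL_apply_norm] at this
    gcongr
  have := (hx abar).add h0
  simpa [← inner_add_right] using this

/-- Lemma 2.1 (demiclosedness): if `a_n − y_n ∈ λA(x_n)` and `y_n ∈ λB(x_n + b_n)`
with `x_n ⇀ x`, `y_n ⇀ y` weakly and `a_n → a`, `b_n → b` strongly, then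
`a − y ∈ λA(x)` and `y ∈ λB(x + b)`. -/
theorem statement3
    {H : Type*} [NormedAddCommGroup H] [InnerProductSpace ℝ H] [CompleteSpace H]
    (lam : ℝ) (hlam : 0 < lam)
    (A B : Set (H × H)) (hA : IsMaximalMonotoneOp A) (hB : IsMaximalMonotoneOp B)
    (x y a b : ℕ → H) (xbar ybar abar bbar : H)
    (hx : ∀ w : H, Tendsto (fun n => ⟪x n, w⟫) atTop (nhds ⟪xbar, w⟫))
    (hy : ∀ w : H, Tendsto (fun n => ⟪y n, w⟫) atTop (nhds ⟪ybar, w⟫))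
    (ha : Tendsto a atTop (nhds abar))
    (hb : Tendsto b atTop (nhds bbar))
    (hmemA : ∀ n : ℕ, (x n, a n - y n) ∈ smulOp lam A)
    (hmemB : ∀ n : ℕ, (x n + b n, y n) ∈ smulOp lam B) :
    (xbar, abar - ybar) ∈ smulOp lam A ∧ (xbar + bbar, ybar) ∈ smulOp lam B := by
  have hA' := smulOp_maximal lam hlam A hA
  have hB' := smulOp_maximal lam hlam B hB
  generalize smulOp lam A = A' at *
  generalize smulOp lam B = B' at *
  have key : ∀ p ∈ A', ∀ q ∈ B',
      (0 : ℝ) ≤ ⟪abar - ybar - p.2, xbar - p.1⟫ + ⟪ybar - q.2, xbar + bbar - q.1⟫ := by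
    intro p hp q hq
    have hn : ∀ n, (0 : ℝ) ≤ ⟪x n, a n - p.2 - q.2⟫ + ⟪y n, b n + p.1 - q.1⟫
        - ⟪a n - p.2, p.1⟫ - ⟪q.2, b n - q.1⟫ := by
      intro n
      have h1 := hA'.1 _ (hmemA n) p hp
      have h2 := hB'.1 _ (hmemB n) q hq
      have h3 := add_nonneg h1 h2
      simp only [inner_sub_left, inner_sub_right, inner_add_right] at h3 ⊢
      linarith [real_inner_comm (x n) (a n), real_inner_comm (x n) (y n),
        real_inner_comm (x n) p.2, real_inner_comm (x n) q.2]
    have hl := (((weak_strong_inner x _ xbar _ hx ((ha.sub_const p.2).sub_const q.2)).add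
      (weak_strong_inner y _ ybar _ hy ((hb.add_const p.1).sub_const q.1))).sub
      ((ha.sub_const p.2).inner (𝕜 := ℝ) (tendsto_const_nhds (x := p.1)))).sub
      ((tendsto_const_nhds (x := q.2)).inner (𝕜 := ℝ) (hb.sub_const q.1))
    have h3 := ge_of_tendsto' hl hn
    simp only [inner_sub_left, inner_sub_right, inner_add_right] at h3 ⊢
    linarith [real_inner_comm xbar abar, real_inner_comm xbar ybar,
        real_inner_comm xbar p.2, real_inner_comm xbar q.2]
  have hAm : (xbar, abar - ybar) ∈ A' := by
    by_contra hcon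
    have h1 : ∃ p ∈ A', ⟪abar - ybar - p.2, xbar - p.1⟫ < 0 := by
      by_contra! h
      exact hcon (hA'.2 _ h)
    obtain ⟨p, hp, hneg⟩ := h1
    have hBm : (xbar + bbar, ybar) ∈ B' :=
      hB'.2 _ fun q hq => by
        have := key p hp q hq
        show 0 ≤ ⟪ybar - q.2, xbar + bbar - q.1⟫
        linarith
    have := key p hp _ hBm
    simp only [sub_self, inner_zero_left] at this
    linarith
  refine ⟨hAm, hB'.2 _ fun q hq => ?_⟩
  simpa using key _ hAm q hq
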